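/- Let x = (x_n) be a real sequence and let ℓ be an ordinary limit point of x. Then for every k ∈ ℕ with k ≥ 1, the set T_k(ℓ) := {ω ∈ (0,1] : d*({n ∈ ℕ : |(x↾ω)_n − ℓ| ≤ ε}) ≥ 1/k for all ε > 0} is comeager in (0,1]. -/

import Mathlib

open Filter Set Topology
open scoped Classical

/-- Upper asymptotic density `d*(X) = limsup_{n→∞} |X ∩ [1,n]| / n`. -/
noncomputable def upperDensity (X : Set ℕ) : ℝ :=
  Filter.limsup
    (fun n : ℕ => (((Finset.Icc 1 n).filter (fun i => i ∈ X)).card : ℝ) / n)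
    Filter.atTop

/-- `ℓ` is an ordinary limit point of `x`: some subsequence converges to `ℓ`. -/
def IsLimitPt (x : ℕ → ℝ) (ℓ : ℝ) : Prop :=
  ∃ φ : ℕ → ℕ, StrictMono φ ∧
    Filter.Tendsto (fun k => x (φ k)) Filter.atTop (nhds ℓ)

/-- `L_x`, the set of ordinary limit points of `x`. -/
def limitPts (x : ℕ → ℝ) : Set ℝ := {ℓ | IsLimitPt x ℓ}

/-- `ℓ` is a statistical cluster point of `x`. -/
def IsStatClusterPt (x : ℕ → ℝ) (ℓ : ℝ) : Prop :=
  ∀ ε : ℝ, 0 < ε → 0 < upperDensity {n : ℕ | |x n - ℓ| ≤ ε}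

/-- `Γ_x`, the set of statistical cluster points of `x`. -/
def statClusterPts (x : ℕ → ℝ) : Set ℝ := {ℓ | IsStatClusterPt x ℓ}

/-- `ℓ` is a statistical limit point of `x`: some subsequence along an index set
of positive upper density converges to `ℓ`. -/
def IsStatLimitPt (x : ℕ → ℝ) (ℓ : ℝ) : Prop :=
  ∃ φ : ℕ → ℕ, StrictMono φ ∧
    Filter.Tendsto (fun k => x (φ k)) Filter.atTop (nhds ℓ) ∧
    0 < upperDensity (Set.range φ)

/-- `Λ_x`, the set of statistical limit points of `x`. -/
def statLimitPts (x : ℕ → ℝ) : Set ℝ := {ℓ | IsStatLimitPt x ℓ}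

/-- The `n`-th binary digit (`n ≥ 1`) of `ω ∈ (0,1]` in the unique binary
representation of `ω` having infinitely many digits equal to `1`:
the partial sums of that representation are `s_N = (⌈2^N ω⌉ - 1)/2^N`. -/
noncomputable def binDigit (ω : ℝ) (n : ℕ) : ℤ :=
  ⌈(2 : ℝ) ^ n * ω⌉ - 2 * ⌈(2 : ℝ) ^ (n - 1) * ω⌉ + 1

/-- The set of indices `n ≥ 1` with `d_n(ω) = 1`. -/
def digitOneSet (ω : ℝ) : Set ℕ := {n | 1 ≤ n ∧ binDigit ω n = 1}

/-- The subsequence `x↾ω` of `x` obtained by choosing, in increasing order,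
all indices `n` with `d_n(ω) = 1`. -/
noncomputable def subseq (x : ℕ → ℝ) (ω : ℝ) : ℕ → ℝ :=
  fun k => x (Nat.nth (fun n => n ∈ digitOneSet ω) k)

/-- `q_{ω,m}(N)`: the proportion, among the first `N` terms of `x↾ω`,
of those within `1/m` of `ℓ`. -/
noncomputable def qdens (x : ℕ → ℝ) (ℓ : ℝ) (ω : ℝ) (m N : ℕ) : ℝ :=
  (((Finset.range N).filter (fun i => |subseq x ω i - ℓ| ≤ 1 / m)).card : ℝ) / N

theorem one_le_upperDensity_of_frequently {X : Set ℕ}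
    (hX : ∀ N : ℕ, ∃ n ≥ N, (1 - 1 / ((N : ℝ) + 1)) * n ≤
      (((Finset.Icc 1 n).filter (fun i => i ∈ X)).card : ℝ)) :
    1 ≤ upperDensity X := by
  have hbdd : Filter.IsBoundedUnder (· ≤ ·) atTop
      (fun n : ℕ => (((Finset.Icc 1 n).filter (fun i => i ∈ X)).card : ℝ) / n) := by
    refine Filter.isBoundedUnder_of ⟨1, fun n => ?_⟩
    refine div_le_one_of_le₀ ?_ (Nat.cast_nonneg n)
    have h := Finset.card_filter_le (Finset.Icc 1 n) (fun i => i ∈ X)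
    rw [Nat.card_Icc, Nat.add_sub_cancel] at h
    exact_mod_cast h
  refine le_of_forall_lt_imp_le_of_dense fun c hc => ?_
  refine Filter.le_limsup_of_frequently_le (Filter.frequently_atTop.2 fun a => ?_) hbdd
  obtain ⟨b, hb⟩ := exists_nat_one_div_lt (sub_pos.2 hc)
  obtain ⟨n, hn, hcard⟩ := hX (max (a + 1) b)
  have hn0 : 0 < n := by omega
  refine ⟨n, by omega, ?_⟩
  rw [le_div_iff₀ (by exact_mod_cast hn0)]
  refine le_trans (mul_le_mul_of_nonneg_right ?_ (Nat.cast_nonneg n)) hcard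
  have hle : 1 / (((max (a + 1) b : ℕ) : ℝ) + 1) ≤ 1 / ((b : ℝ) + 1) := by
    gcongr
    exact le_max_right _ _
  linarith

theorem le_nth_of_count_le_of_lt_count {P : ℕ → Prop} {a b i : ℕ}
    (ha : Nat.count P a ≤ i) (hb : i < Nat.count P b) : a ≤ Nat.nth P i := by
  by_contra! hlt
  have hi : ∀ hf : (Set.ofPred P).Finite, i < hf.toFinset.card :=
    fun hf => hb.trans_le (Nat.count_le_card hf b)
  have h := Nat.count_monotone P (Nat.succ_le_of_lt hlt)
  rw [Nat.succ_eq_add_one, Nat.count_nth_succ hi] at h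
  omega

theorem count_le_card_filter_nth_mem {P : ℕ → Prop} {S : Set ℕ} {a b : ℕ}
    (hPS : ∀ n, a ≤ n → n < b → P n → n ∈ S) :
    Nat.count P b ≤
      ((Finset.Icc 1 (Nat.count P b)).filter (fun i => Nat.nth P i ∈ S)).card + (a + 1) := by
  have hsub : Finset.Ico (a + 1) (Nat.count P b) ⊆
      (Finset.Icc 1 (Nat.count P b)).filter (fun i => Nat.nth P i ∈ S) := by
    intro i hi
    obtain ⟨hai, hib⟩ := Finset.mem_Ico.1 hi
    refine Finset.mem_filter.2 ⟨Finset.mem_Icc.2 ⟨by omega, hib.le⟩, ?_⟩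
    refine hPS _ (le_nth_of_count_le_of_lt_count ?_ hib) (Nat.nth_lt_of_lt_count hib)
      (Nat.nth_mem i fun hf => hib.trans_le (Nat.count_le_card hf b))
    have := Nat.count_le P (n := a)
    omega
  have h := Finset.card_le_card hsub
  rw [Nat.card_Ico] at h
  omega

/-- The value `⌈2 ^ (m + j) * ω⌉` for any `ω` with `⌈2 ^ m * ω⌉ = c` whose binary digits after
the `m`-th one are given by the indicator function of `S`. -/
noncomputable def ceilWithDigits (S : Set ℕ) (m : ℕ) (c : ℤ) : ℕ → ℤ
  | 0 => c
  | j + 1 => 2 * ceilWithDigits S m c j - 1 + if m + (j + 1) ∈ S then 1 else 0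

theorem ceil_two_pow_mul_eq_of_succ {S : Set ℕ} {m : ℕ} {c : ℤ} {ω : ℝ} {j : ℕ}
    (h : ⌈(2 : ℝ) ^ (m + (j + 1)) * ω⌉ = ceilWithDigits S m c (j + 1)) :
    ⌈(2 : ℝ) ^ (m + j) * ω⌉ = ceilWithDigits S m c j := by
  rw [Int.ceil_eq_iff] at h ⊢
  rw [ceilWithDigits, ← add_assoc, pow_succ] at h
  push_cast at h
  split_ifs at h <;> constructor <;> linarith [h.1, h.2]

theorem ceil_two_pow_mul_eq_of_le {S : Set ℕ} {m : ℕ} {c : ℤ} {ω : ℝ} {i j : ℕ} (hij : i ≤ j)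
    (h : ⌈(2 : ℝ) ^ (m + j) * ω⌉ = ceilWithDigits S m c j) :
    ⌈(2 : ℝ) ^ (m + i) * ω⌉ = ceilWithDigits S m c i :=
  Nat.decreasingInduction
    (motive := fun i _ => ⌈(2 : ℝ) ^ (m + i) * ω⌉ = ceilWithDigits S m c i)
    (fun _ _ => ceil_two_pow_mul_eq_of_succ) h hij

theorem mem_digitOneSet_iff_of_ceil_eq {S : Set ℕ} {m : ℕ} {c : ℤ} {ω : ℝ} {j n : ℕ}
    (h : ⌈(2 : ℝ) ^ (m + j) * ω⌉ = ceilWithDigits S m c j) (hmn : m < n) (hnj : n ≤ m + j) :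
    n ∈ digitOneSet ω ↔ n ∈ S := by
  obtain ⟨i, rfl⟩ := Nat.exists_eq_add_of_lt hmn
  have h₀ := ceil_two_pow_mul_eq_of_le (i := i) (by omega) h
  have h₁ := ceil_two_pow_mul_eq_of_le (i := i + 1) (by omega) h
  have hdigit : binDigit ω (m + i + 1) = if m + (i + 1) ∈ S then 1 else 0 := by
    rw [binDigit, Nat.add_sub_cancel, add_assoc, h₀, h₁, ceilWithDigits]
    ring
  simp only [digitOneSet, Set.mem_ofPred_eq, hdigit, ← add_assoc]
  split_ifs with hS <;> simp [hS]

theorem mem_Ioc_of_ceil_eq {m : ℕ} {ω ω' : ℝ} (hω : ω ∈ Set.Ioc (0 : ℝ) 1)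
    (h : ⌈(2 : ℝ) ^ m * ω'⌉ = ⌈(2 : ℝ) ^ m * ω⌉) : ω' ∈ Set.Ioc (0 : ℝ) 1 := by
  have hpow : (0 : ℝ) < 2 ^ m := by positivity
  have hpos : 0 < ⌈(2 : ℝ) ^ m * ω'⌉ := h ▸ Int.ceil_pos.2 (mul_pos hpow hω.1)
  have hle : ⌈(2 : ℝ) ^ m * ω'⌉ ≤ 2 ^ m := by
    rw [h, Int.ceil_le]
    push_cast
    nlinarith [hω.2]
  rw [Int.ceil_le] at hle
  push_cast at hle
  exact ⟨pos_of_mul_pos_right (Int.ceil_pos.1 hpos) hpow.le,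
    le_of_mul_le_mul_left (by linarith) hpow⟩

theorem abs_sub_lt_of_ceil_eq {m : ℕ} {ω ω' : ℝ}
    (h : ⌈(2 : ℝ) ^ m * ω'⌉ = ⌈(2 : ℝ) ^ m * ω⌉) : |ω' - ω| < (1 / 2) ^ m := by
  have hpow : (0 : ℝ) < 2 ^ m := by positivity
  have hscaled : |(2 : ℝ) ^ m * (ω' - ω)| < 1 := by
    rw [Int.ceil_eq_iff] at h
    rw [abs_lt]
    constructor <;> linarith [h.1, h.2, Int.le_ceil ((2 : ℝ) ^ m * ω),
      Int.ceil_lt_add_one ((2 : ℝ) ^ m * ω)]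
  rw [abs_mul, abs_of_pos hpow] at hscaled
  rwa [one_div_pow, lt_div_iff₀' hpow]

theorem exists_isOpen_forall_ceil_eq {O : Set (Set.Ioc (0 : ℝ) 1)} (hO : IsOpen O)
    (hne : O.Nonempty) (S : Set ℕ) :
    ∃ (m : ℕ) (c : ℤ), ∀ j, ∃ V ⊆ O, IsOpen V ∧ V.Nonempty ∧
      ∀ ω ∈ V, ⌈(2 : ℝ) ^ (m + j) * ω.1⌉ = ceilWithDigits S m c j := by
  obtain ⟨ω₀, hω₀⟩ := hne
  obtain ⟨r, hr, hball⟩ := Metric.isOpen_iff.1 hO ω₀ hω₀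
  obtain ⟨m, hm⟩ := exists_pow_lt_of_lt_one hr (by norm_num : (1 / 2 : ℝ) < 1)
  refine ⟨m, ⌈(2 : ℝ) ^ m * ω₀.1⌉, fun j => ?_⟩
  set C := ceilWithDigits S m ⌈(2 : ℝ) ^ m * ω₀.1⌉ j
  have hceil : ∀ ω : ℝ, (2 : ℝ) ^ (m + j) * ω ∈ Set.Ioo ((C : ℝ) - 1) C →
      ⌈(2 : ℝ) ^ (m + j) * ω⌉ = C := fun ω h => Int.ceil_eq_iff.2 ⟨h.1, h.2.le⟩
  have hceil₀ : ∀ ω : ℝ, (2 : ℝ) ^ (m + j) * ω ∈ Set.Ioo ((C : ℝ) - 1) C →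
      ⌈(2 : ℝ) ^ m * ω⌉ = ⌈(2 : ℝ) ^ m * ω₀.1⌉ :=
    fun ω h => ceil_two_pow_mul_eq_of_le (Nat.zero_le j) (hceil ω h)
  refine ⟨{ω | (2 : ℝ) ^ (m + j) * ω.1 ∈ Set.Ioo ((C : ℝ) - 1) C}, fun ω hω => hball ?_,
    isOpen_Ioo.preimage (by fun_prop), ?_, fun ω hω => hceil ω.1 hω⟩
  · exact (abs_sub_lt_of_ceil_eq (hceil₀ ω.1 hω)).trans hm
  · have hmid : (2 : ℝ) ^ (m + j) * (((C : ℝ) - 1 / 2) / 2 ^ (m + j)) ∈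
        Set.Ioo ((C : ℝ) - 1) C := by
      rw [mul_div_cancel₀ _ (by positivity)]
      constructor <;> linarith
    exact ⟨⟨_, mem_Ioc_of_ceil_eq ω₀.2 (hceil₀ _ hmid)⟩, hmid⟩

theorem IsLimitPt.infinite_setOf_abs_sub_le {x : ℕ → ℝ} {ℓ : ℝ} (h : IsLimitPt x ℓ) {ε : ℝ}
    (hε : 0 < ε) : {n : ℕ | |x n - ℓ| ≤ ε}.Infinite := by
  obtain ⟨φ, hφ, hlim⟩ := h
  refine Nat.frequently_atTop_iff_infinite.1 (hφ.tendsto_atTop.frequently ?_)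
  refine Filter.Eventually.frequently ?_
  filter_upwards [Metric.tendsto_nhds.1 hlim ε hε] with k hk
  exact hk.le

theorem dense_interior_setOf_exists_card_le {x : ℕ → ℝ} {ℓ : ℝ} (h : IsLimitPt x ℓ) {ε : ℝ}
    (hε : 0 < ε) (N : ℕ) :
    Dense (interior {ω : Set.Ioc (0 : ℝ) 1 | ∃ n ≥ N, (1 - 1 / ((N : ℝ) + 1)) * n ≤
      (((Finset.Icc 1 n).filter
        (fun i => i ∈ {n : ℕ | |subseq x ω.1 n - ℓ| ≤ ε})).card : ℝ)}) := by
  set S : Set ℕ := {n | |x n - ℓ| ≤ ε}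
  rw [dense_iff_inter_open]
  intro O hO hne
  obtain ⟨m, c, hV⟩ := exists_isOpen_forall_ceil_eq hO hne S
  have hinf : (Set.ofPred fun n => m < n ∧ n ∈ S).Infinite := by
    refine ((h.infinite_setOf_abs_sub_le hε).sdiff (Set.finite_Iic m)).mono fun n hn => ?_
    exact ⟨not_le.1 hn.2, hn.1⟩
  set Q := (N + 1) * (m + 2) with hQ
  set j := Nat.nth (fun n => m < n ∧ n ∈ S) Q
  have hcount : Nat.count (fun n => m < n ∧ n ∈ S) j = Q := Nat.count_nth_of_infinite hinf Q
  obtain ⟨V, hVO, hVopen, ⟨ω₁, hω₁⟩, hVceil⟩ := hV j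
  refine ⟨ω₁, hVO hω₁, mem_interior.2 ⟨V, fun ω hω => ?_, hVopen, hω₁⟩⟩
  have hdigit : ∀ n, m < n → n ≤ m + j → (n ∈ digitOneSet ω.1 ↔ n ∈ S) :=
    fun n => mem_digitOneSet_iff_of_ceil_eq (hVceil ω hω)
  have hQle : Q ≤ Nat.count (fun n => n ∈ digitOneSet ω.1) j := by
    rw [← hcount]
    exact Nat.count_mono_left fun n hn hnS => (hdigit n hnS.1 (by omega)).2 hnS.2
  have hcard := count_le_card_filter_nth_mem (P := fun n => n ∈ digitOneSet ω.1) (S := S)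
    (a := m + 1) (b := j) fun n hmn hnj hn => (hdigit n hmn (by omega)).1 hn
  refine ⟨Nat.count (fun n => n ∈ digitOneSet ω.1) j, by nlinarith, ?_⟩
  change _ ≤ (((Finset.Icc 1 (Nat.count (fun n => n ∈ digitOneSet ω.1) j)).filter
    (fun i => Nat.nth (fun n => n ∈ digitOneSet ω.1) i ∈ S)).card : ℝ)
  set t := Nat.count (fun n => n ∈ digitOneSet ω.1) j
  have hN : (0 : ℝ) < (N : ℝ) + 1 := by positivity
  have htm : (m : ℝ) + 2 ≤ t / ((N : ℝ) + 1) := by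
    rw [le_div_iff₀ hN, mul_comm]
    exact_mod_cast hQle
  have hcard' : (t : ℝ) ≤ (((Finset.Icc 1 t).filter
      (fun i => Nat.nth (fun n => n ∈ digitOneSet ω.1) i ∈ S)).card : ℝ) + (m + 1 + 1) := by
    exact_mod_cast hcard
  rw [sub_mul, one_mul, one_div_mul_eq_div]
  linarith

/-- If `ℓ` is an ordinary limit point of `x` and `k ≥ 1`, then
`T_k(ℓ) = {ω ∈ (0,1] : d*({n : |(x↾ω)_n − ℓ| ≤ ε}) ≥ 1/k for all ε > 0}`
is comeager in `(0,1]`. -/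
theorem stmt8 (x : ℕ → ℝ) (ℓ : ℝ) (h : IsLimitPt x ℓ) (k : ℕ) (hk : 1 ≤ k) :
    {ω : Set.Ioc (0 : ℝ) 1 |
        ∀ ε : ℝ, 0 < ε →
          (1 : ℝ) / k ≤ upperDensity {n : ℕ | |subseq x ω.1 n - ℓ| ≤ ε}} ∈
      residual (Set.Ioc (0 : ℝ) 1) := by
  have hres : ∀ᶠ ω in residual (Set.Ioc (0 : ℝ) 1), ∀ p N : ℕ, ∃ n ≥ N,
      (1 - 1 / ((N : ℝ) + 1)) * n ≤ (((Finset.Icc 1 n).filter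
        (fun i => i ∈ {n : ℕ | |subseq x ω.1 n - ℓ| ≤ 1 / ((p : ℝ) + 1)})).card : ℝ) := by
    refine eventually_countable_forall.2 fun p => eventually_countable_forall.2 fun N => ?_
    exact Filter.mem_of_superset (residual_of_dense_open isOpen_interior
      (dense_interior_setOf_exists_card_le h (by positivity) N)) interior_subset
  filter_upwards [hres] with ω hω ε hε
  obtain ⟨p, hp⟩ := exists_nat_one_div_lt hε
  have hk' : (1 : ℝ) / k ≤ 1 :=
    div_le_one_of_le₀ (by exact_mod_cast hk) (Nat.cast_nonneg k)
  refine hk'.trans (one_le_upperDensity_of_frequently fun N => ?_)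
  obtain ⟨n, hn, hcard⟩ := hω p N
  refine ⟨n, hn, hcard.trans ?_⟩
  gcongr with i
  intro hi
  exact le_trans hi hp.le
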